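/- Let β > 0, R > 0, K ≥ 1, n ≥ 1, let r_1, …, r_K be real numbers with r_i ∈ [−R, R], let T_1, …, T_K be nonnegative reals with Σ_{i=1}^K T_i = n, and let i* ∈ {1,…,K} be any distinguished index. Then the difference between the log-sum-exp aggregate and the weighted average satisfies: n · [ (1/β) ln((1/n) Σ_{i=1}^K T_i exp(β r_i)) − (1/n) Σ_{i=1}^K T_i r_i ] ≤ (Σ_{i ≠ i*} T_i) · (exp(2βR) − 2βR − 1)/β. Moreover the left-hand side is nonnegative, i.e., (1/β) ln((1/n) Σ_i T_i exp(β r_i)) ≥ (1/n) Σ_i T_i r_i. -/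

import Mathlib

theorem exp_sub_self_le_of_abs_le {y c : ℝ} (h : |y| ≤ c) :
    Real.exp y - y ≤ Real.exp c - c := by
  have key : ∀ x : ℝ, 0 ≤ x → x ≤ c → Real.exp x - x ≤ Real.exp c - c := by
    intro x hx hxc
    have h1 : Real.exp c = Real.exp x * Real.exp (c - x) := by
      rw [← Real.exp_add]; congr 1; ring
    have h2 := Real.add_one_le_exp (c - x)
    have h3 := Real.one_le_exp hx
    nlinarith [mul_nonneg (sub_nonneg.2 h3) (sub_nonneg.2 hxc)]
  obtain hy | hy := le_total 0 y
  · exact key y hy ((le_abs_self y).trans h)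
  · have h1 := key (-y) (neg_nonneg.2 hy) ((neg_le_abs y).trans h)
    have h2 : -y ≤ Real.sinh (-y) := Real.self_le_sinh_iff.2 (neg_nonneg.2 hy)
    rw [Real.sinh_eq, neg_neg] at h2
    linarith

/-- Jensen's inequality for `exp`, in logarithmic form with unnormalized weights. -/
theorem weighted_sum_div_le_log_sum_exp {ι : Type*} (s : Finset ι) (w x : ι → ℝ) {N : ℝ}
    (hN : 0 < N) (hw : ∀ i ∈ s, 0 ≤ w i) (hsum : ∑ i ∈ s, w i = N) :
    (∑ i ∈ s, w i * x i) / N ≤ Real.log ((∑ i ∈ s, w i * Real.exp (x i)) / N) := by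
  have h := convexOn_exp.map_sum_le (t := s) (w := fun i => w i / N) (p := x)
    (fun i hi => div_nonneg (hw i hi) hN.le)
    (by rw [← Finset.sum_div, hsum, div_self hN.ne']) (fun _ _ => Set.mem_univ _)
  simp only [smul_eq_mul, div_mul_eq_mul_div, ← Finset.sum_div] at h
  exact (Real.le_log_iff_exp_le ((Real.exp_pos _).trans_le h)).2 h

/-- Upper bound on the log-sum-exp obtained from `log z ≤ z - 1` after centring at `a`. -/
theorem log_sum_exp_sub_le {ι : Type*} (s : Finset ι) (w x : ι → ℝ) (a : ℝ) {N : ℝ}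
    (hN : 0 < N) (hw : ∀ i ∈ s, 0 ≤ w i) (hsum : ∑ i ∈ s, w i = N) :
    N * Real.log ((∑ i ∈ s, w i * Real.exp (x i)) / N) - ∑ i ∈ s, w i * x i
      ≤ ∑ i ∈ s, w i * (Real.exp (x i - a) - (x i - a) - 1) := by
  set Z := ∑ i ∈ s, w i * Real.exp (x i - a) with hZ
  have hpos : 0 < Z := by
    obtain ⟨i, hi, hne⟩ := Finset.exists_ne_zero_of_sum_ne_zero (hsum.trans_ne hN.ne')
    exact Finset.sum_pos' (fun j hj => mul_nonneg (hw j hj) (Real.exp_pos _).le)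
      ⟨i, hi, mul_pos ((hw i hi).lt_of_ne' hne) (Real.exp_pos _)⟩
  have hshift : ∑ i ∈ s, w i * Real.exp (x i) = Real.exp a * Z := by
    rw [hZ, Finset.mul_sum]
    refine Finset.sum_congr rfl fun i _ => ?_
    rw [mul_left_comm, ← Real.exp_add, add_sub_cancel]
  have hexpand : ∑ i ∈ s, w i * (Real.exp (x i - a) - (x i - a) - 1)
      = Z - ∑ i ∈ s, w i * x i + N * a - N := by
    rw [hZ, ← hsum, Finset.sum_mul, ← Finset.sum_sub_distrib, ← Finset.sum_add_distrib,
      ← Finset.sum_sub_distrib]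
    exact Finset.sum_congr rfl fun i _ => by ring
  have hlog := mul_le_mul_of_nonneg_left (Real.log_le_sub_one_of_pos (div_pos hpos hN)) hN.le
  rw [mul_sub, mul_div_cancel₀ _ hN.ne'] at hlog
  rw [hshift, hexpand, mul_div_assoc, Real.log_mul (Real.exp_pos a).ne' (div_pos hpos hN).ne',
    Real.log_exp]
  linarith


/-- deterministic comparison between the log-sum-exp (stream-ERM) aggregate
and the weighted average, for weights `T_i ≥ 0` summing to `n` and values `r_i ∈ [−R,R]`:
the difference is at most `(Σ_{i≠i*} T_i)·(exp(2βR) − 2βR − 1)/β`, and it is nonnegative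
(Jensen). -/
theorem stmt12 (β R : ℝ) (hβ : 0 < β) (hR : 0 < R) (K : ℕ) (hK : 1 ≤ K)
    (n : ℕ) (hn : 1 ≤ n) (r : Fin K → ℝ) (hr : ∀ i, r i ∈ Set.Icc (-R) R)
    (T : Fin K → ℝ) (hT : ∀ i, 0 ≤ T i) (hTsum : ∑ i, T i = (n : ℝ))
    (istar : Fin K) :
    (n : ℝ) * ((1 / β) * Real.log ((1 / (n : ℝ)) * ∑ i, T i * Real.exp (β * r i))
        - (1 / (n : ℝ)) * ∑ i, T i * r i)
      ≤ (∑ i ∈ Finset.univ.erase istar, T i)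
          * ((Real.exp (2 * β * R) - 2 * β * R - 1) / β) ∧
    (1 / (n : ℝ)) * ∑ i, T i * r i
      ≤ (1 / β) * Real.log ((1 / (n : ℝ)) * ∑ i, T i * Real.exp (β * r i)) := by
  have hN : (0 : ℝ) < n := by exact_mod_cast hn
  have hlin : ∑ i, T i * (β * r i) = β * ∑ i, T i * r i := by
    rw [Finset.mul_sum]
    exact Finset.sum_congr rfl fun i _ => by ring
  have hlower := weighted_sum_div_le_log_sum_exp Finset.univ T (fun i => β * r i) hN
    (fun i _ => hT i) hTsum
  have hupper := log_sum_exp_sub_le Finset.univ T (fun i => β * r i) (β * r istar) hN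
    (fun i _ => hT i) hTsum
  simp only [hlin] at hlower hupper
  rw [one_div_mul_eq_div, one_div_mul_eq_div, one_div_mul_eq_div]
  set L := Real.log ((∑ i, T i * Real.exp (β * r i)) / n)
  constructor
  · have hbound : ∑ i, T i * (Real.exp (β * r i - β * r istar) - (β * r i - β * r istar) - 1)
        ≤ (∑ i ∈ Finset.univ.erase istar, T i) * (Real.exp (2 * β * R) - 2 * β * R - 1) := by
      rw [← Finset.sum_erase (a := istar) Finset.univ (by simp), Finset.sum_mul]
      refine Finset.sum_le_sum fun i _ => mul_le_mul_of_nonneg_left ?_ (hT i)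
      refine sub_le_sub_right (exp_sub_self_le_of_abs_le ?_) 1
      obtain ⟨hi, hi'⟩ := hr i
      obtain ⟨hs, hs'⟩ := hr istar
      rw [abs_le]
      constructor <;> nlinarith
    have hscale : (n : ℝ) * (L / β - (∑ i, T i * r i) / n)
        = (n * L - β * ∑ i, T i * r i) / β := by
      field_simp
    rw [hscale, ← mul_div_assoc]
    exact div_le_div_of_nonneg_right (hupper.trans hbound) hβ.le
  · rw [le_div_iff₀ hβ]
    calc (∑ i, T i * r i) / n * β = (β * ∑ i, T i * r i) / n := by ring
      _ ≤ L := hlower
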